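/- Let ℓ = e₃ + e₄ (null), and define the 2-forms V_{ab} = (ℓ♭)_a (e₁♭)_b − (e₁♭)_a (ℓ♭)_b and W_{ab} = (ℓ♭)_a (e₂♭)_b − (e₂♭)_a (ℓ♭)_b. Let R be the covariant 4-tensor R_{abcd} = A·(η∘η)_{abcd} + B·(η∘(ℓ♭⊗ℓ♭))_{abcd} + C·(V_{ab}V_{cd} − W_{ab}W_{cd}) with A, B, C ∈ ℝ and C ≠ 0 (Petrov type N curvature aligned with ℓ, with possible aligned null radiation and cosmological term). Then the stabilizer g₀(R) is exactly the 2-dimensional abelian subalgebra of null rotations about ℓ, spanned by N₁ and N₂, where Nᵢ is the matrix defined by Nᵢ v = η(eᵢ,v)ℓ − η(ℓ,v)eᵢ for i = 1,2. -/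

import Mathlib

/- STATEMENT 4. Work in ℝ⁴ with the Minkowski form η = diag(1,1,1,−1).  Let
ℓ = e₃ + e₄ (null), V_{ab} = ℓ♭_a e₁♭_b − e₁♭_a ℓ♭_b,
W_{ab} = ℓ♭_a e₂♭_b − e₂♭_a ℓ♭_b, and
R = A·(η∘η) + B·(η∘(ℓ♭⊗ℓ♭)) + C·(V V − W W) with C ≠ 0 (Petrov type N).
Then g₀(R) is exactly the 2-dimensional abelian subalgebra of null rotations
about ℓ, spanned by N₁ and N₂, where Nᵢ v = η(eᵢ,v)ℓ − η(ℓ,v)eᵢ. -/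

open Matrix

noncomputable section

abbrev Mat4 := Matrix (Fin 4) (Fin 4) ℝ
abbrev Tensor4 := Fin 4 → Fin 4 → Fin 4 → Fin 4 → ℝ

/-- The Minkowski form η = diag(1,1,1,−1). -/
def ηm : Mat4 := Matrix.diagonal ![1, 1, 1, -1]

/-- η as a (symmetric bilinear) array h_{ab}. -/
def ηf : Fin 4 → Fin 4 → ℝ := fun a b => ηm a b

/-- u♭, the covector η(u,·). -/
def flat (u : Fin 4 → ℝ) : Fin 4 → ℝ := ηm.mulVec u

/-- Membership in the Lorentz Lie algebra so(1,3): Mᵀη + ηM = 0. -/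
def inSO13 (M : Mat4) : Prop := Mᵀ * ηm + ηm * M = 0

/-- Kulkarni–Nomizu product of two symmetric bilinear forms. -/
def kn (h k : Fin 4 → Fin 4 → ℝ) : Tensor4 := fun a b c d =>
  h a c * k b d + h b d * k a c - h a d * k b c - h b c * k a d

/-- The action of so(1,3) on covariant 4-tensors:
    (M·R)_{abcd} = −Σ_e (Mᵉ_a R_{ebcd} + Mᵉ_b R_{aecd} + Mᵉ_c R_{abed} + Mᵉ_d R_{abce}). -/
def act (M : Mat4) (R : Tensor4) : Tensor4 := fun a b c d =>
  -(∑ e : Fin 4, (M e a * R e b c d + M e b * R a e c d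
      + M e c * R a b e d + M e d * R a b c e))

/-- The stabilizer g₀(R) = {M ∈ so(1,3) : M·R = 0}. -/
def stab (R : Tensor4) : Set Mat4 := {M : Mat4 | inSO13 M ∧ act M R = 0}

/-- η as a bilinear form on vectors. -/
def ηb (x y : Fin 4 → ℝ) : ℝ := x ⬝ᵥ ηm.mulVec y

/-- The null vector ℓ = e₃ + e₄. -/
def lvec : Fin 4 → ℝ := ![0, 0, 1, 1]

/-- The 2-form V_{ab} = (ℓ♭)_a (w♭)_b − (w♭)_a (ℓ♭)_b. -/
def Vform (w : Fin 4 → ℝ) : Fin 4 → Fin 4 → ℝ := fun a b =>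
  flat lvec a * flat w b - flat w a * flat lvec b

/-- R_{abcd} = A·(η∘η) + B·(η∘(ℓ♭⊗ℓ♭)) + C·(V_{ab}V_{cd} − W_{ab}W_{cd}),
with V, W built from e₁, e₂ respectively. -/
def RtenN (A B C : ℝ) : Tensor4 := fun a b c d =>
  A * kn ηf ηf a b c d
    + B * kn ηf (fun i j => flat lvec i * flat lvec j) a b c d
    + C * (Vform ![1,0,0,0] a b * Vform ![1,0,0,0] c d
            - Vform ![0,1,0,0] a b * Vform ![0,1,0,0] c d)

/-- The matrix of the null rotation determined by w:  v ↦ η(w,v)u − η(u,v)w. -/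
def rotM (u w : Fin 4 → ℝ) : Mat4 :=
  Matrix.of fun a b => u a * flat w b - w a * flat u b

/-- N₁, the null rotation about ℓ with N₁ v = η(e₁,v)ℓ − η(ℓ,v)e₁. -/
def N1 : Mat4 := rotM lvec ![1, 0, 0, 0]

/-- N₂, the null rotation about ℓ with N₂ v = η(e₂,v)ℓ − η(ℓ,v)e₂. -/
def N2 : Mat4 := rotM lvec ![0, 1, 0, 0]

theorem ηm_apply (a b : Fin 4) : ηm a b = if a = b then ![1, 1, 1, -1] a else 0 := by
  rw [ηm, Matrix.diagonal_apply]

theorem flat_apply (u : Fin 4 → ℝ) (a : Fin 4) : flat u a = ![1, 1, 1, -1] a * u a := by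
  rw [flat, ηm, Matrix.mulVec_diagonal]

theorem N1_eq : N1 = !![0, 0, -1, 1; 0, 0, 0, 0; 1, 0, 0, 0; 1, 0, 0, 0] := by
  ext i j
  fin_cases i <;> fin_cases j <;> simp [N1, rotM, flat_apply, lvec]

theorem N2_eq : N2 = !![0, 0, 0, 0; 0, 0, -1, 1; 0, 1, 0, 0; 0, 1, 0, 0] := by
  ext i j
  fin_cases i <;> fin_cases j <;> simp [N2, rotM, flat_apply, lvec]

theorem rotM_mulVec (u w v : Fin 4 → ℝ) :
    (rotM u w).mulVec v = ηb w v • u - ηb u v • w := by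
  ext i
  simp [rotM, Matrix.mulVec, dotProduct, ηb, flat_apply, Fin.sum_univ_four, ηm_apply]
  ring

theorem inSO13_iff (M : Mat4) :
    inSO13 M ↔ ∀ i j, M j i * ![1, 1, 1, -1] j + ![1, 1, 1, -1] i * M i j = 0 := by
  simp only [inSO13, ηm, ← Matrix.ext_iff, Matrix.add_apply, Matrix.mul_diagonal,
    Matrix.diagonal_mul, Matrix.transpose_apply, Matrix.zero_apply]

theorem commute_N1_N2 : Commute N1 N2 := by
  rw [commute_iff_eq, N1_eq, N2_eq]
  ext i j
  fin_cases i <;> fin_cases j <;> simp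

theorem linearIndependent_N1_N2 : LinearIndependent ℝ ![N1, N2] := by
  rw [LinearIndependent.pair_iff]
  intro s t h
  rw [N1_eq, N2_eq] at h
  exact ⟨by simpa using congrFun (congrFun h 2) 0, by simpa using congrFun (congrFun h 2) 1⟩

theorem exists_of_mem_stab {A B C : ℝ} (hC : C ≠ 0) {M : Mat4} (hM : M ∈ stab (RtenN A B C)) :
    ∃ a b : ℝ, a • N1 + b • N2 = M := by
  obtain ⟨hso, hact⟩ := hM
  rw [inSO13_iff] at hso
  have h00 := hso 0 0
  have h11 := hso 1 1
  have h22 := hso 2 2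
  have h33 := hso 3 3
  have h01 := hso 0 1
  have h02 := hso 0 2
  have h03 := hso 0 3
  have h12 := hso 1 2
  have h13 := hso 1 3
  have h23 := hso 2 3
  have hR (a b c d : Fin 4) : act M (RtenN A B C) a b c d = 0 := by rw [hact]; rfl
  have e1 := hR 0 2 1 2
  have e2 := hR 0 2 0 2
  have e3 := hR 1 2 1 2
  have e4 := hR 0 1 0 2
  have e5 := hR 1 2 2 3
  have e6 := hR 0 2 2 3
  have e7 := hR 0 1 1 2
  simp [act, RtenN, kn, ηf, ηm_apply, Vform, flat_apply, lvec, Fin.sum_univ_four]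
    at h00 h11 h22 h33 h01 h02 h03 h12 h13 h23 e1 e2 e3 e4 e5 e6 e7
  rw [add_eq_zero_iff_eq_neg] at h01 h02 h12
  rw [neg_add_eq_zero] at h03 h13 h23
  rw [h01] at e1
  rw [h00, h22, h23] at e2
  rw [h11, h22, h23] at e3
  rw [h12, h13] at e4
  rw [h13] at e5
  rw [h03] at e6
  rw [h02, h03] at e7
  have p : M 0 1 = 0 := mul_left_cancel₀ hC (by linear_combination -(1 / 2) * e1)
  have z : M 2 3 = 0 := mul_left_cancel₀ hC (by linear_combination (1 / 4) * (e2 - e3))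
  have y : M 1 2 = -M 1 3 := mul_left_cancel₀ hC (by linear_combination (1 / 2) * (e4 - e5))
  have x : M 0 2 = -M 0 3 := mul_left_cancel₀ hC (by linear_combination (1 / 2) * (e6 + e7))
  refine ⟨M 0 3, M 1 3, ?_⟩
  rw [N1_eq, N2_eq]
  ext i j
  fin_cases i <;> fin_cases j <;>
    simp [h00, h11, h22, h33, h01, h02, h03, h12, h13, h23, p, z, y, x]

/-- The infinitesimal action of `M` on bilinear forms, up to sign. -/
def formAct (M : Mat4) (h : Fin 4 → Fin 4 → ℝ) (a b : Fin 4) : ℝ :=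
  ∑ e : Fin 4, (M e a * h e b + M e b * h a e)

theorem act_kn (M : Mat4) (h k : Fin 4 → Fin 4 → ℝ) :
    act M (kn h k) = -(kn (formAct M h) k + kn h (formAct M k)) := by
  funext a b c d
  simp only [act, kn, formAct, Fin.sum_univ_four, Pi.neg_apply, Pi.add_apply]
  ring

theorem act_mul (M : Mat4) (F G : Fin 4 → Fin 4 → ℝ) :
    act M (fun a b c d => F a b * G c d) =
      -fun a b c d => formAct M F a b * G c d + F a b * formAct M G c d := by
  funext a b c d
  simp only [act, formAct, Fin.sum_univ_four, Pi.neg_apply]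
  ring

theorem act_add (M : Mat4) (R S : Tensor4) : act M (R + S) = act M R + act M S := by
  funext a b c d
  simp only [act, Fin.sum_univ_four, Pi.add_apply]
  ring

theorem act_smul (M : Mat4) (r : ℝ) (R : Tensor4) : act M (r • R) = r • act M R := by
  funext a b c d
  simp only [act, Fin.sum_univ_four, Pi.smul_apply, smul_eq_mul]
  ring

theorem act_RtenN_eq_zero {M : Mat4} (A B C : ℝ) (hη : formAct M ηf = 0)
    (hl : formAct M (fun i j => flat lvec i * flat lvec j) = 0)
    (hV : formAct M (Vform ![1, 0, 0, 0]) = 0) (hW : formAct M (Vform ![0, 1, 0, 0]) = 0) :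
    act M (RtenN A B C) = 0 := by
  have hR : RtenN A B C = A • kn ηf ηf + B • kn ηf (fun i j => flat lvec i * flat lvec j)
      + C • ((fun a b c d => Vform ![1, 0, 0, 0] a b * Vform ![1, 0, 0, 0] c d)
        + (-1 : ℝ) • fun a b c d => Vform ![0, 1, 0, 0] a b * Vform ![0, 1, 0, 0] c d) := by
    funext a b c d
    simp only [RtenN, Pi.add_apply, Pi.smul_apply, smul_eq_mul]
    ring
  rw [hR]
  simp only [act_add, act_smul, act_kn, act_mul, hη, hl, hV, hW]
  funext a b c d
  simp [kn]

theorem act_rotation_eq_zero (A B C a b : ℝ) : act (a • N1 + b • N2) (RtenN A B C) = 0 := by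
  rw [N1_eq, N2_eq]
  apply act_RtenN_eq_zero <;> funext i j <;> fin_cases i <;> fin_cases j <;>
    simp [formAct, ηf, ηm_apply, Vform, flat_apply, lvec, Fin.sum_univ_four]

theorem rotation_mem_stab (A B C a b : ℝ) : a • N1 + b • N2 ∈ stab (RtenN A B C) := by
  refine ⟨(inSO13_iff _).2 fun i j => ?_, act_rotation_eq_zero A B C a b⟩
  rw [N1_eq, N2_eq]
  fin_cases i <;> fin_cases j <;> simp

/-- With C ≠ 0, the stabilizer g₀(R) of the Petrov type N curvature tensor R is
exactly the 2-dimensional abelian subalgebra of null rotations about ℓ, spanned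
by N₁ and N₂ (where Nᵢ is the matrix with Nᵢ v = η(eᵢ,v)ℓ − η(ℓ,v)eᵢ). -/
theorem stabilizer_type_N (A B C : ℝ) (hC : C ≠ 0) :
    (∀ v : Fin 4 → ℝ, N1.mulVec v = ηb ![1,0,0,0] v • lvec - ηb lvec v • ![1,0,0,0]) ∧
    (∀ v : Fin 4 → ℝ, N2.mulVec v = ηb ![0,1,0,0] v • lvec - ηb lvec v • ![0,1,0,0]) ∧
    stab (RtenN A B C) = ↑(Submodule.span ℝ ({N1, N2} : Set Mat4)) ∧
    Module.finrank ℝ ↥(Submodule.span ℝ ({N1, N2} : Set Mat4)) = 2 ∧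
    (∀ M ∈ stab (RtenN A B C), ∀ N ∈ stab (RtenN A B C), ⁅M, N⁆ = 0) := by
  have hstab : stab (RtenN A B C) = ↑(Submodule.span ℝ ({N1, N2} : Set Mat4)) := by
    ext M
    rw [SetLike.mem_coe, Submodule.mem_span_pair]
    refine ⟨exists_of_mem_stab hC, ?_⟩
    rintro ⟨a, b, rfl⟩
    exact rotation_mem_stab A B C a b
  refine ⟨rotM_mulVec _ _, rotM_mulVec _ _, hstab, ?_, fun M hM N hN => ?_⟩
  · have h := finrank_span_eq_card linearIndependent_N1_N2
    rwa [Matrix.range_cons_cons_empty, Fintype.card_fin] at h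
  · obtain ⟨a, b, rfl⟩ := exists_of_mem_stab hC hM
    obtain ⟨c, d, rfl⟩ := exists_of_mem_stab hC hN
    rw [Ring.lie_def, sub_eq_zero]
    have h1 (t : ℝ) : Commute N1 (c • N1 + t • N2) :=
      ((Commute.refl N1).smul_right c).add_right (commute_N1_N2.smul_right t)
    have h2 (t : ℝ) : Commute N2 (t • N1 + d • N2) :=
      (commute_N1_N2.symm.smul_right t).add_right ((Commute.refl N2).smul_right d)
    exact ((h1 d).smul_left a).add_left ((h2 c).smul_left b)

end
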